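/- Fix γ ∈ (0,1) and R ∈ (0,γ), and let θ = (0,1). There exist δ > 0 (the tent-width parameter of F), c > 0 and r > 0 such that for every dθ ∈ ℝ² with 0 < ‖dθ‖ < r, the combined cost difference of the two atomic initial states is strictly positive and bounded below: (C[x⋆](θ + dθ) − C[x⋆](θ)) + (C[y⋆](θ + dθ) − C[y⋆](θ)) ≥ c·‖dθ‖₁. -/

import Mathlib

open MeasureTheory

/-- The tent (spike) function of width `2δ` centered at `a`. -/
noncomputable def tent (a δ x : ℝ) : ℝ :=
  if x ∈ Set.Icc (a - δ) a then (x - (a - δ)) / δ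
  else if x ∈ Set.Icc a (a + δ) then ((a + δ) - x) / δ
  else 0

/-- The nonlinear feature `F(x) = ω₀|x| + Σᵢ ωᵢ Λ_{aᵢ,δᵢ}(x)` with the paper's parameters
`ω₀ = −0.5, a₁ = −2, δ₁ = 0.1, ω₁ = 3, a₂ = 1.5, a₃ = 1.8, ω₂ = ω₃ = 0.2, δ₂ = δ₃ = δ`. -/
noncomputable def Fex (δ x : ℝ) : ℝ :=
  (-0.5) * |x| + 3 * tent (-2) 0.1 x + 0.2 * tent 1.5 δ x + 0.2 * tent 1.8 δ x

/-- The closed-loop trajectory: `x₀ = z`, `x_{t+1} = u_t = θ₀ x_t + θ₁ F(x_t)`. -/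
noncomputable def traj (δ : ℝ) (θ : ℝ × ℝ) (z : ℝ) : ℕ → ℝ
  | 0 => z
  | t + 1 => θ.1 * traj δ θ z t + θ.2 * Fex δ (traj δ θ z t)

/-- The discounted cost `C[z](θ) = Σ_t γᵗ (x_t² + R u_t²)` (note `u_t = x_{t+1}`). -/
noncomputable def cost (γ R δ : ℝ) (θ : ℝ × ℝ) (z : ℝ) : ℝ :=
  ∑' t : ℕ, γ ^ t * ((traj δ θ z t) ^ 2 + R * (traj δ θ z (t + 1)) ^ 2)

/-- `x⋆ = min F⁻¹({a₂})`, the smallest preimage of `a₂ = 1.5` under `F`. -/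
noncomputable def xstar (δ : ℝ) : ℝ := sInf {x : ℝ | Fex δ x = 1.5}

/-- `y⋆ = min F⁻¹({a₃})`, the smallest preimage of `a₃ = 1.8` under `F`. -/
noncomputable def ystar (δ : ℝ) : ℝ := sInf {x : ℝ | Fex δ x = 1.8}

/-- The ℓ¹ norm `‖(a,b)‖₁ = |a| + |b|` on `ℝ²`. -/
noncomputable def l1 (dθ : ℝ × ℝ) : ℝ := |dθ.1| + |dθ.2|

lemma tent_of_abs_le {a δ x : ℝ} (hδ : 0 < δ) (h : |x - a| ≤ δ) :
    tent a δ x = 1 - |x - a| / δ := by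
  obtain ⟨h1, h2⟩ := abs_le.mp h
  unfold tent
  rcases le_total x a with hx | hx
  · rw [if_pos ⟨by linarith, hx⟩, abs_of_nonpos (by linarith)]
    field_simp
    ring
  · rw [abs_of_nonneg (by linarith)]
    split_ifs with h3 h4
    · obtain rfl : x = a := le_antisymm h3.2 hx
      field_simp
      ring
    · field_simp
      ring
    · exact absurd ⟨hx, by linarith⟩ h4

lemma tent_of_le_abs {a δ x : ℝ} (hδ : 0 < δ) (h : δ ≤ |x - a|) : tent a δ x = 0 := by
  rcases h.eq_or_lt with h | h
  · rw [tent_of_abs_le hδ h.ge, ← h, div_self hδ.ne', sub_self]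
  · unfold tent
    rw [if_neg, if_neg]
    · rintro ⟨h1, h2⟩
      rw [abs_of_nonneg (by linarith)] at h
      linarith
    · rintro ⟨h1, h2⟩
      rw [abs_of_nonpos (by linarith)] at h
      linarith

/-- On the nonpositive half-line only the spike at `-2` contributes. -/
lemma Fex_of_nonpos {δ x : ℝ} (hδ : 0 < δ) (hδ' : δ ≤ 0.1) (hx : x ≤ 0) :
    Fex δ x = 0.5 * x + 3 * tent (-2) 0.1 x := by
  unfold Fex
  rw [tent_of_le_abs (a := 1.5) hδ, tent_of_le_abs (a := 1.8) hδ, abs_of_nonpos hx]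
  · ring
  · rw [abs_of_nonpos (by linarith)]; linarith
  · rw [abs_of_nonpos (by linarith)]; linarith

lemma Fex_half {δ x : ℝ} (hδ : 0 < δ) (hδ' : δ ≤ 0.1) (hx : x ≤ 0)
    (h : 0.1 ≤ |x - (-2)|) : Fex δ x = 0.5 * x := by
  rw [Fex_of_nonpos hδ hδ' hx, tent_of_le_abs (by norm_num) h]
  ring

lemma Fex_spike {δ x : ℝ} (hδ : 0 < δ) (hδ' : δ ≤ 0.1) (h1 : -2.1 ≤ x) (h2 : x ≤ -2) :
    Fex δ x = 30.5 * x + 63 := by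
  rw [Fex_of_nonpos hδ hδ' (by linarith)]
  have h : |x - (-2)| = -(x + 2) := by rw [abs_of_nonpos (by linarith)]; ring
  rw [tent_of_abs_le (by norm_num) (by rw [h]; linarith), h]
  ring

lemma sInf_Fex_preimage {δ s : ℝ} (hδ : 0 < δ) (hδ' : δ ≤ 0.1) (h1 : 0 ≤ s) (h2 : s ≤ 2) :
    sInf {x : ℝ | Fex δ x = s} = (s - 63) / 30.5 := by
  have hz : 30.5 * ((s - 63) / 30.5) + 63 = s := by ring
  generalize (s - 63) / 30.5 = z at *
  refine IsLeast.csInf_eq ⟨?_, ?_⟩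
  · change Fex δ _ = s
    rw [Fex_spike hδ hδ' (by linarith) (by linarith), hz]
  · intro x hx
    change Fex δ x = s at hx
    by_contra! hlt
    rcases le_total x (-2.1) with h | h
    · rw [Fex_half hδ hδ' (by linarith)
        (by rw [abs_of_nonpos (by linarith)]; linarith)] at hx
      linarith
    · rw [Fex_spike hδ hδ' h (by linarith)] at hx
      linarith

lemma Fex_near_a₂ {δ e : ℝ} (hδ : 0 < δ) (hδ' : δ ≤ 0.1) (he : |e| ≤ δ) :
    Fex δ (1.5 + e) = -1.5 / 2 + 0.2 - e / 2 - 0.2 * |e| / δ := by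
  obtain ⟨h1, h2⟩ := abs_le.mp he
  unfold Fex
  rw [tent_of_le_abs (a := -2) (by norm_num), tent_of_le_abs (a := 1.8) hδ,
    tent_of_abs_le (a := 1.5) hδ, abs_of_nonneg (show 0 ≤ 1.5 + e by linarith),
    add_sub_cancel_left]
  · ring
  · simpa using he
  · rw [abs_of_nonpos (by linarith)]; linarith
  · rw [abs_of_nonneg (by linarith)]; linarith

lemma Fex_near_a₃ {δ e : ℝ} (hδ : 0 < δ) (hδ' : δ ≤ 0.1) (he : |e| ≤ δ) :
    Fex δ (1.8 + e) = -1.8 / 2 + 0.2 - e / 2 - 0.2 * |e| / δ := by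
  obtain ⟨h1, h2⟩ := abs_le.mp he
  unfold Fex
  rw [tent_of_le_abs (a := -2) (by norm_num), tent_of_le_abs (a := 1.5) hδ,
    tent_of_abs_le (a := 1.8) hδ, abs_of_nonneg (show 0 ≤ 1.8 + e by linarith),
    add_sub_cancel_left]
  · ring
  · simpa using he
  · rw [abs_of_nonneg (by linarith)]; linarith
  · rw [abs_of_nonneg (by linarith)]; linarith

/-- Once the state lies between the spike at `-2` and `0`, the closed loop is linear. -/
lemma traj_add_two {δ z k : ℝ} {θ : ℝ × ℝ} (hδ : 0 < δ) (hδ' : δ ≤ 0.1)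
    (hk : k = θ.1 + 0.5 * θ.2) (hk0 : 0 ≤ k) (hk1 : k ≤ 1)
    (h1 : -1 ≤ traj δ θ z 2) (h2 : traj δ θ z 2 ≤ 0) (t : ℕ) :
    traj δ θ z (t + 2) = k ^ t * traj δ θ z 2 := by
  induction t with
  | zero => simp
  | succ t ih =>
    have hp0 : 0 ≤ k ^ t := pow_nonneg hk0 t
    have hp1 : k ^ t ≤ 1 := pow_le_one₀ hk0 hk1
    have hx0 : k ^ t * traj δ θ z 2 ≤ 0 := mul_nonpos_of_nonneg_of_nonpos hp0 h2
    have hx1 : -1 ≤ k ^ t * traj δ θ z 2 := by nlinarith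
    have step : traj δ θ z (t + 1 + 2) =
        θ.1 * traj δ θ z (t + 2) + θ.2 * Fex δ (traj δ θ z (t + 2)) := rfl
    rw [step, ih, Fex_half hδ hδ' hx0 (by rw [abs_of_nonneg (by linarith)]; linarith), hk]
    ring

lemma cost_eq {γ R δ z k : ℝ} {θ : ℝ × ℝ} (hγ0 : 0 ≤ γ) (hγ1 : γ < 1)
    (hδ : 0 < δ) (hδ' : δ ≤ 0.1)
    (hk : k = θ.1 + 0.5 * θ.2) (hk0 : 0 ≤ k) (hk1 : k ≤ 1)
    (h1 : -1 ≤ traj δ θ z 2) (h2 : traj δ θ z 2 ≤ 0) :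
    cost γ R δ θ z =
      z ^ 2 + (R + γ) * (traj δ θ z 1 ^ 2 + γ * (traj δ θ z 2 ^ 2 * (1 - γ * k ^ 2)⁻¹)) := by
  have hq0 : 0 ≤ γ * k ^ 2 := by positivity
  have hq1 : γ * k ^ 2 < 1 := by nlinarith [pow_le_one₀ hk0 hk1 (n := 2)]
  have hgeo := (hasSum_geometric_of_lt_one hq0 hq1).mul_left
    (γ ^ 2 * traj δ θ z 2 ^ 2 * (1 + R * k ^ 2))
  have htail : HasSum (fun t : ℕ => γ ^ (t + 2) *
      (traj δ θ z (t + 2) ^ 2 + R * traj δ θ z (t + 2 + 1) ^ 2))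
      (γ ^ 2 * traj δ θ z 2 ^ 2 * (1 + R * k ^ 2) * (1 - γ * k ^ 2)⁻¹) := by
    refine hgeo.congr_fun ?_
    intro t
    have e1 := traj_add_two (z := z) hδ hδ' hk hk0 hk1 h1 h2 t
    have e2 := traj_add_two (z := z) hδ hδ' hk hk0 hk1 h1 h2 (t + 1)
    rw [show t + 2 + 1 = t + 1 + 2 by ring, e1, e2, mul_pow]
    ring
  have hsum := (hasSum_nat_add_iff (f := fun t : ℕ => γ ^ t *
      (traj δ θ z t ^ 2 + R * traj δ θ z (t + 1) ^ 2)) 2).mp htail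
  rw [cost, hsum.tsum_eq, Finset.sum_range_succ, Finset.sum_range_one]
  have h0 : traj δ θ z 0 = z := rfl
  have hne : 1 - γ * k ^ 2 ≠ 0 := by linarith
  simp only [h0, zero_add, pow_zero, pow_one, one_mul, Nat.reduceAdd]
  field_simp
  ring

lemma inv_one_sub_lower_bound {γ k : ℝ} (hγ0 : 0 ≤ γ) (hγ1 : γ ≤ 1) {N : ℝ}
    (hN : |k - 1 / 2| ≤ N) (hu : γ * k ^ 2 < 1) :
    (1 - γ * (1 / 2) ^ 2)⁻¹ - 2 * N ≤ (1 - γ * k ^ 2)⁻¹ := by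
  obtain ⟨hN1, -⟩ := abs_le.mp hN
  have hN0 : 0 ≤ N := (abs_nonneg _).trans hN
  have hv : 0 < 1 - γ * (1 / 2) ^ 2 := by linarith
  have hu' : 0 < 1 - γ * k ^ 2 := by linarith
  have hsq : (1 - γ * (1 / 2) ^ 2)⁻¹ ≤ 4 / 3 := by
    rw [inv_le_comm₀ hv (by norm_num)]; linarith
  set w := (1 - γ * (1 / 2) ^ 2)⁻¹ with hw
  have hw0 : 0 < w := inv_pos.mpr hv
  have hwv : w * (1 - γ * (1 / 2) ^ 2) = 1 := inv_mul_cancel₀ hv.ne'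
  have hd : -N ≤ γ * k ^ 2 - γ * (1 / 2) ^ 2 := by
    nlinarith [mul_nonneg hγ0 (sq_nonneg (k - 1 / 2)), mul_nonneg hγ0 hN0]
  have htangent : w + w ^ 2 * (γ * k ^ 2 - γ * (1 / 2) ^ 2) ≤ (1 - γ * k ^ 2)⁻¹ := by
    rw [← one_div, le_div_iff₀ hu']
    have hexp : (w + w ^ 2 * (γ * k ^ 2 - γ * (1 / 2) ^ 2)) * (1 - γ * k ^ 2) =
        1 - (w * (γ * k ^ 2 - γ * (1 / 2) ^ 2)) ^ 2 := by
      linear_combination (1 + w * (γ * k ^ 2 - γ * (1 / 2) ^ 2)) * hwv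
    rw [hexp]
    exact sub_le_self _ (sq_nonneg _)
  nlinarith [mul_le_mul_of_nonneg_left hd (sq_nonneg w),
    mul_nonneg hN0 (show 0 ≤ 2 - w ^ 2 by nlinarith)]

/-- The real-number estimate behind `cost_increase`: `e` is the displacement of the first step, `X`
the perturbed and `f` the unperturbed second step, `G` and `G'` the geometric series of the tails. -/
lemma step_cost_increase {γ s e f X G G' N E : ℝ} (hγ0 : 0 ≤ γ) (hγ1 : γ ≤ 1)
    (hs0 : 0 ≤ s) (hs2 : s ≤ 1.8) (hN0 : 0 ≤ N) (hE0 : 0 ≤ E) (he1 : -(2.1 * N) ≤ e)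
    (hf1 : -0.7 ≤ f) (hf2 : f ≤ -0.5) (hdrop : X - f ≤ 5 * N - 0.1 * E)
    (hG1 : 1 ≤ G) (hG2 : G ≤ 2) (hG : G' - 2 * N ≤ G) :
    γ * (0.1 * E) - 23 * N ≤ (s + e) ^ 2 - s ^ 2 + γ * (X ^ 2 * G - f ^ 2 * G') := by
  have hsq : 0.1 * E - 7 * N ≤ X ^ 2 - f ^ 2 := by
    have p1 := mul_nonneg (show 0 ≤ -2 * f by linarith)
      (show 0 ≤ 5 * N - 0.1 * E - (X - f) by linarith)
    have p2 := mul_nonneg (show 0 ≤ 1.4 + 2 * f by linarith) hN0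
    have p3 := mul_nonneg (show 0 ≤ -1 - 2 * f by linarith) hE0
    linarith [sq_nonneg (X - f)]
  have hprod : 0.1 * E - 15 * N ≤ X ^ 2 * G - f ^ 2 * G' := by
    have hff : f ^ 2 ≤ 0.49 := by
      linarith [mul_nonneg (show 0 ≤ 0.7 + f by linarith) (show 0 ≤ 0.7 - f by linarith)]
    linarith [mul_nonneg (show 0 ≤ G by linarith)
        (show 0 ≤ X ^ 2 - f ^ 2 - (0.1 * E - 7 * N) by linarith),
      mul_nonneg hE0 (show 0 ≤ G - 1 by linarith),
      mul_nonneg hN0 (show 0 ≤ 2 - G by linarith),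
      mul_nonneg (sq_nonneg f) (show 0 ≤ G - (G' - 2 * N) by linarith),
      mul_nonneg hN0 (show 0 ≤ 0.49 - f ^ 2 by linarith)]
  have hfirst : -8 * N ≤ (s + e) ^ 2 - s ^ 2 := by
    linarith [sq_nonneg e, mul_nonneg (show 0 ≤ s by linarith) (show 0 ≤ e + 2.1 * N by linarith),
      mul_nonneg (show 0 ≤ 1.8 - s by linarith) hN0]
  linarith [mul_le_mul_of_nonneg_left hprod hγ0, mul_nonneg hN0 (sub_nonneg.mpr hγ1)]

/-- Cost increase of a trajectory that starts on the spike at `-2` and whose first step hits the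
centre `s` of a thin tent: the tent contributes a term of order `|e| / δ`, where `e` is the
displacement of the first step. -/
lemma cost_increase {γ R δ s z : ℝ} (hγ0 : 0 < γ) (hγ1 : γ < 1) (hR : 0 < R)
    (hδ : 0 < δ) (hδ' : δ ≤ 0.1) (hs1 : 1.5 ≤ s) (hs2 : s ≤ 1.8)
    (hz1 : -2.1 ≤ z) (hz2 : z ≤ -2) (hFz : Fex δ z = s)
    (hF : ∀ e, |e| ≤ δ → Fex δ (s + e) = -s / 2 + 0.2 - e / 2 - 0.2 * |e| / δ)
    {ε : ℝ × ℝ} (hε : l1 ε ≤ δ / 50) :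
    (R + γ) * (γ * (0.1 * (|ε.1 * z + ε.2 * s| / δ)) - 23 * l1 ε) ≤
      cost γ R δ (((0, 1) : ℝ × ℝ) + ε) z - cost γ R δ ((0, 1) : ℝ × ℝ) z := by
  obtain ⟨a, b⟩ := ε
  simp only [l1] at hε ⊢
  have hN0 : 0 ≤ |a| + |b| := by positivity
  set N := |a| + |b| with hN
  have ha := abs_le.mp (show |a| ≤ N by linarith [abs_nonneg b])
  have hb := abs_le.mp (show |b| ≤ N by linarith [abs_nonneg a])
  set e := a * z + b * s with he
  have heN : |e| ≤ 2.1 * N := by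
    calc |e| ≤ |a * z| + |b * s| := abs_add_le _ _
      _ = |a| * |z| + |b| * |s| := by rw [abs_mul, abs_mul]
      _ ≤ |a| * 2.1 + |b| * 2.1 := by
        gcongr <;> rw [abs_le] <;> constructor <;> linarith
      _ = 2.1 * N := by rw [hN]; ring
  have heδ : |e| ≤ δ / 20 := by linarith
  obtain ⟨he1, he2⟩ := abs_le.mp heN
  set E := |e| / δ with hE
  have hE0 : 0 ≤ E := by positivity
  have hE1 : E ≤ 1 / 20 := by rw [hE, div_le_iff₀ hδ]; linarith
  have hNs : N ≤ 0.002 := by linarith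
  have x1 : traj δ (((0, 1) : ℝ × ℝ) + (a, b)) z 1 = s + e := by
    simp only [traj, Prod.mk_add_mk, hFz, he]
    ring
  have x2 : traj δ (((0, 1) : ℝ × ℝ) + (a, b)) z 2 =
      a * (s + e) + (1 + b) * (-s / 2 + 0.2 - e / 2 - 0.2 * E) := by
    have step : traj δ (((0, 1) : ℝ × ℝ) + (a, b)) z 2 =
      (0 + a) * traj δ (((0, 1) : ℝ × ℝ) + (a, b)) z 1 +
      (1 + b) * Fex δ (traj δ (((0, 1) : ℝ × ℝ) + (a, b)) z 1) := rfl
    rw [step, x1, hF e (by linarith), hE]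
    ring
  have y1 : traj δ ((0, 1) : ℝ × ℝ) z 1 = s := by
    simp only [traj, hFz]
    ring
  have y2 : traj δ ((0, 1) : ℝ × ℝ) z 2 = -s / 2 + 0.2 := by
    have step : traj δ ((0, 1) : ℝ × ℝ) z 2 =
      0 * traj δ ((0, 1) : ℝ × ℝ) z 1 + 1 * Fex δ (traj δ ((0, 1) : ℝ × ℝ) z 1) := rfl
    have := hF 0 (by simpa using hδ.le)
    rw [step, y1]
    simp only [add_zero, abs_zero] at this
    rw [this]
    ring
  set f := -s / 2 + 0.2 with hf
  set X := a * (s + e) + (1 + b) * (f - e / 2 - 0.2 * E) with hX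
  have has : |a * (s + e)| ≤ 2 * N := by
    rw [abs_mul, mul_comm]
    gcongr
    · rw [abs_le]; constructor <;> linarith
    · linarith [abs_nonneg b]
  obtain ⟨has1, has2⟩ := abs_le.mp has
  have hbf : |b * (f - e / 2)| ≤ 1 * N := by
    rw [abs_mul, mul_comm]
    gcongr
    · rw [abs_le]; constructor <;> linarith
    · linarith [abs_nonneg a]
  obtain ⟨hbf1, hbf2⟩ := abs_le.mp hbf
  have hbE1 : b * E ≤ 0.5 * E := mul_le_mul_of_nonneg_right (by linarith) hE0
  have hbE2 : -0.5 * E ≤ b * E := mul_le_mul_of_nonneg_right (by linarith) hE0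
  have hXeq : X = a * (s + e) + b * (f - e / 2) + f - e / 2 - 0.2 * E - 0.2 * (b * E) := by
    rw [hX]; ring
  have hdrop : X - f ≤ 5 * N - 0.1 * E := by linarith
  have hX0 : X ≤ 0 := by linarith
  have hX1 : -1 ≤ X := by linarith
  have hf1 : -0.7 ≤ f := by linarith
  have hf2 : f ≤ -0.5 := by linarith
  clear_value X f E e N
  set k := a + 0.5 * (1 + b) with hk
  have hk0 : 0 ≤ k := by linarith
  have hk1 : k ≤ 0.7 := by linarith
  have hkN : |k - 1 / 2| ≤ N := by
    rw [show k - 1 / 2 = a + 0.5 * b by rw [hk]; ring]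
    refine (abs_add_le _ _).trans ?_
    rw [abs_mul, abs_of_pos (by norm_num : (0 : ℝ) < 0.5)]
    linarith [abs_nonneg b]
  have hkk : γ * k ^ 2 ≤ 1 / 2 := by
    have hk2 : k ^ 2 ≤ 0.7 ^ 2 := pow_le_pow_left₀ hk0 hk1 2
    linarith [mul_le_mul hγ1.le hk2 (sq_nonneg k) zero_le_one]
  have hG := inv_one_sub_lower_bound hγ0.le hγ1.le hkN (by linarith)
  have hG1 : 1 ≤ (1 - γ * k ^ 2)⁻¹ :=
    (one_le_inv₀ (by linarith)).mpr (by linarith [mul_nonneg hγ0.le (sq_nonneg k)])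
  have hG2 : (1 - γ * k ^ 2)⁻¹ ≤ 2 := by
    rw [inv_le_comm₀ (by linarith) (by norm_num)]; linarith
  have c1 := cost_eq (γ := γ) (R := R) (z := z) (θ := ((0, 1) : ℝ × ℝ) + (a, b)) (k := k)
    hγ0.le hγ1 hδ hδ' (by simp [hk]) hk0 (by linarith) (by rw [x2]; exact hX1)
    (by rw [x2]; exact hX0)
  have c2 := cost_eq (γ := γ) (R := R) (z := z) (θ := ((0, 1) : ℝ × ℝ)) (k := 1 / 2)
    hγ0.le hγ1 hδ hδ' (by norm_num) (by norm_num) (by norm_num) (by rw [y2]; linarith)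
    (by rw [y2]; linarith)
  rw [c1, c2, x1, x2, y1, y2]
  generalize (1 - γ * k ^ 2)⁻¹ = G at *
  generalize (1 - γ * (1 / 2) ^ 2)⁻¹ = G' at *
  have hmain := step_cost_increase hγ0.le hγ1.le (by linarith) hs2 hN0 hE0 he1 hf1 hf2 hdrop
    hG1 hG2 hG
  calc _ ≤ (R + γ) * ((s + e) ^ 2 - s ^ 2 + γ * (X ^ 2 * G - f ^ 2 * G')) :=
        mul_le_mul_of_nonneg_left hmain (by linarith)
    _ = _ := by ring

/-- Combined lower bound for the atomic part of the initial-state distribution: for suitable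
tent width `δ`, every small nonzero perturbation `dθ` of `θ = (0,1)` increases the sum of the
costs of the trajectories started at `x⋆` and `y⋆` by at least `c·‖dθ‖₁`. -/
theorem combined_cost_increase (γ R : ℝ)
    (hγ : γ ∈ Set.Ioo (0 : ℝ) 1) (hR : R ∈ Set.Ioo (0 : ℝ) γ) :
    ∃ δ > (0 : ℝ), ∃ c > (0 : ℝ), ∃ r > (0 : ℝ),
      ∀ dθ : ℝ × ℝ, dθ ≠ 0 → ‖dθ‖ < r →
        c * l1 dθ ≤
          (cost γ R δ (((0, 1) : ℝ × ℝ) + dθ) (xstar δ) -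
            cost γ R δ ((0, 1) : ℝ × ℝ) (xstar δ)) +
          (cost γ R δ (((0, 1) : ℝ × ℝ) + dθ) (ystar δ) -
            cost γ R δ ((0, 1) : ℝ × ℝ) (ystar δ)) := by
  obtain ⟨hγ0, hγ1⟩ := hγ
  obtain ⟨hR0, -⟩ := hR
  have hδ : 0 < γ / 8000 := by positivity
  have hδ' : γ / 8000 ≤ 0.1 := by linarith
  refine ⟨γ / 8000, hδ, γ, hγ0, γ / 8000 / 100, by positivity, fun ε _ hε => ?_⟩
  have hl1 : l1 ε ≤ γ / 8000 / 50 := by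
    have h1 := norm_fst_le ε
    have h2 := norm_snd_le ε
    rw [Real.norm_eq_abs] at h1 h2
    unfold l1
    linarith
  have hx := cost_increase (s := 1.5) (z := (1.5 - 63) / 30.5) hγ0 hγ1 hR0 hδ hδ'
    (by norm_num) (by norm_num) (by norm_num) (by norm_num)
    (by rw [Fex_spike hδ hδ' (by norm_num) (by norm_num)]; norm_num)
    (fun e => Fex_near_a₂ hδ hδ') hl1
  have hy := cost_increase (s := 1.8) (z := (1.8 - 63) / 30.5) hγ0 hγ1 hR0 hδ hδ'
    (by norm_num) (by norm_num) (by norm_num) (by norm_num)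
    (by rw [Fex_spike hδ hδ' (by norm_num) (by norm_num)]; norm_num)
    (fun e => Fex_near_a₃ hδ hδ') hl1
  rw [xstar, ystar, sInf_Fex_preimage hδ hδ' (by norm_num) (by norm_num),
    sInf_Fex_preimage hδ hδ' (by norm_num) (by norm_num)]
  refine le_trans ?_ (add_le_add hx hy)
  obtain ⟨a, b⟩ := ε
  simp only [l1]
  set e₁ := a * ((1.5 - 63) / 30.5) + b * 1.5 with he₁
  set e₂ := a * ((1.8 - 63) / 30.5) + b * 1.8 with he₂
  have hN : |a| + |b| ≤ 8 * (|e₁| + |e₂|) := by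
    have p1 := le_abs_self e₁
    have p2 := neg_le_abs e₁
    have p3 := le_abs_self e₂
    have p4 := neg_le_abs e₂
    have ha : |a| ≤ 3 * (|e₁| + |e₂|) := by
      rw [abs_le]; constructor <;> linarith
    have hb : |b| ≤ 5 * (|e₁| + |e₂|) := by
      obtain ⟨q1, q2⟩ := abs_le.mp ha
      rw [abs_le]; constructor <;> linarith
    linarith
  have hscale : ∀ x : ℝ, γ * (0.1 * (x / (γ / 8000))) = 800 * x := by
    intro x
    field_simp
    ring
  rw [hscale, hscale]
  have hN0 : 0 ≤ |a| + |b| := by positivity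
  nlinarith [mul_le_mul_of_nonneg_left hN (show 0 ≤ R + γ by linarith), mul_nonneg hR0.le hN0,
    mul_nonneg hγ0.le hN0]
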